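/- arXiv:2307.06817 — 2 statements merged into one kernel-verified Lean document; each statement's English description precedes it below -/
import Mathlib

section
/- Let X and Y be independent random variables on a probability space, each almost surely positive, with Lebesgue densities f_X and f_Y, and let Z = X/(X+Y) with density f_Z. Suppose there exist positive continuous functions A, B on (0,∞) and constants q > 0, λ > 0, p ≥ 0 such that f_Y(s*x) = A(s) * B(x) * (p + q*s*x) * exp(-λ*s*x) for all s, x > 0, f_X is continuous on (0,∞), and lim_{x→0+} x^{(λ*p/q)+2} * B(x) * f_X(x) = 0. If h : (0,∞) → ℝ is a continuous function such that for every s > 0 the integral ∫_0^∞ exp(-s*ξ) * h(ξ) dξ converges and equals (1/(A(s/λ)*(s+λ)^2)) * f_Z(λ/(s+λ)), and the functions x ↦ x*B(x)*f_X(x)*exp(-s*x) and x ↦ x^2*B(x)*f_X(x)*exp(-s*x) are integrable on (0,∞) for every s > 0, then for every x > 0: f_X(x) = (λ^3/(q * x^{(λ*p/q)+2} * B(x))) * ∫_0^x ξ^{λ*p/q} * h(ξ) dξ. -/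
open MeasureTheory ProbabilityTheory Real Set Filter
open scoped ENNReal

/-- A function on the half line whose Laplace transform exists and vanishes on `(0, ∞)` is zero
almost everywhere. -/
theorem ae_eq_zero_of_laplace_eq_zero {F : ℝ → ℝ}
    (hint : ∀ s ∈ Ioi (0:ℝ), IntegrableOn (fun x => Real.exp (-(s * x)) * F x) (Ioi 0))
    (hzero : ∀ s ∈ Ioi (0:ℝ), ∫ x in Ioi (0:ℝ), Real.exp (-(s * x)) * F x = 0) :
    F =ᵐ[volume.restrict (Ioi 0)] 0 := by
  set ν := volume.restrict (Ioi (0:ℝ))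
  set G : ℝ → ℝ := fun x => Real.exp (-(1 * x)) * F x with hG
  have hGi : Integrable G ν := hint 1 (by simp)
  have key : ∀ H : ℝ → ℝ, AEMeasurable H ν → (∀ x, |H x| ≤ |G x|) → ∀ t < (1:ℝ),
      Integrable (fun x => H x * Real.exp (t * x)) ν := by
    intro H hH hle t ht
    refine Integrable.mono' (hint (1 - t) (by simpa using ht)).norm
      (by exact (hH.mul (by fun_prop)).aestronglyMeasurable) (ae_of_all _ fun x => ?_)
    have : Real.exp (-((1 - t) * x)) * F x = G x * Real.exp (t * x) := by
      rw [hG]; simp only; rw [mul_right_comm, ← Real.exp_add]; ring_nf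
    rw [this, norm_mul, norm_mul]
    exact mul_le_mul_of_nonneg_right (hle x) (norm_nonneg _)
  have hfin : ∀ H : ℝ → ℝ, AEMeasurable H ν → (∀ x, 0 ≤ H x) → (∀ x, |H x| ≤ |G x|) →
      ∀ t < (1:ℝ), Integrable (fun x => Real.exp (t * x))
          (ν.withDensity fun x => ENNReal.ofReal (H x)) ∧
        mgf id (ν.withDensity fun x => ENNReal.ofReal (H x)) t =
          ∫ x, H x * Real.exp (t * x) ∂ν := by
    intro H hH h0 hle t ht
    constructor
    · rw [integrable_withDensity_iff_integrable_smul₀' hH.ennreal_ofReal (by simp)]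
      simpa [ENNReal.toReal_ofReal (h0 _)] using key H hH hle t ht
    · rw [mgf, integral_withDensity_eq_integral_toReal_smul₀ hH.ennreal_ofReal (by simp)]
      simp [ENNReal.toReal_ofReal (h0 _)]
  set p : ℝ → ℝ := fun x => max (G x) 0
  set m : ℝ → ℝ := fun x => max (-G x) 0
  have hpm : AEMeasurable p ν := hGi.aemeasurable.max aemeasurable_const
  have hmm : AEMeasurable m ν := hGi.aemeasurable.neg.max aemeasurable_const
  have hp0 : ∀ x, 0 ≤ p x := fun x => le_max_right _ _
  have hm0 : ∀ x, 0 ≤ m x := fun x => le_max_right _ _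
  have hple : ∀ x, |p x| ≤ |G x| := fun x => by
    rw [abs_of_nonneg (hp0 x)]; exact max_le (le_abs_self _) (abs_nonneg _)
  have hmle : ∀ x, |m x| ≤ |G x| := fun x => by
    rw [abs_of_nonneg (hm0 x)]; exact max_le (neg_le_abs _) (abs_nonneg _)
  set μ₁ := ν.withDensity fun x => ENNReal.ofReal (p x)
  set μ₂ := ν.withDensity fun x => ENNReal.ofReal (m x)
  have hpi : Integrable p ν := by simpa using key p hpm hple 0 one_pos
  have hmi : Integrable m ν := by simpa using key m hmm hmle 0 one_pos
  have : IsFiniteMeasure μ₁ := isFiniteMeasure_withDensity_ofReal hpi.2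
  have : IsFiniteMeasure μ₂ := isFiniteMeasure_withDensity_ofReal hmi.2
  have hset₁ : Iio (1:ℝ) ⊆ interior (integrableExpSet id μ₁) :=
    isOpen_Iio.subset_interior_iff.2 fun t ht => (hfin p hpm hp0 hple t ht).1
  have hset₂ : Iio (1:ℝ) ⊆ interior (integrableExpSet id μ₂) :=
    isOpen_Iio.subset_interior_iff.2 fun t ht => (hfin m hmm hm0 hmle t ht).1
  have hmgf : ∀ t < (1:ℝ), mgf id μ₁ t = mgf id μ₂ t := by
    intro t ht
    rw [(hfin p hpm hp0 hple t ht).2, (hfin m hmm hm0 hmle t ht).2, ← sub_eq_zero,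
      ← integral_sub (key p hpm hple t ht) (key m hmm hmle t ht),
      ← hzero (1 - t) (by simpa using ht)]
    refine integral_congr_ae (ae_of_all _ fun x => ?_)
    have h1 : p x - m x = G x := by
      simp only [p, m]
      rcases le_total (G x) 0 with h | h
      · rw [max_eq_right h, max_eq_left (by linarith)]; ring
      · rw [max_eq_left h, max_eq_right (by linarith)]; ring
    have h2 : Real.exp (-((1 - t) * x)) * F x = G x * Real.exp (t * x) := by
      rw [hG]; simp only; rw [mul_right_comm, ← Real.exp_add]; ring_nf
    simp only [h2, ← h1]; ring
  have hEq : EqOn (complexMGF id μ₁) (complexMGF id μ₂) {z | z.re ∈ Iio (1:ℝ)} := by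
    have ho : IsOpen {z : ℂ | z.re ∈ Iio (1:ℝ)} := isOpen_Iio.preimage Complex.continuous_re
    refine AnalyticOnNhd.eqOn_of_preconnected_of_frequently_eq (z₀ := 0)
      (fun z hz => analyticOnNhd_complexMGF z (hset₁ hz))
      (fun z hz => analyticOnNhd_complexMGF z (hset₂ hz))
      ((convex_Iio 1).linear_preimage Complex.reLm |>.isPreconnected) (by simp) ?_
    have hfr : ∃ᶠ x : ℝ in nhdsWithin 0 {0}ᶜ, mgf id μ₁ x = mgf id μ₂ x := by
      apply Eventually.frequently
      exact mem_nhdsWithin_of_mem_nhds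
        (mem_of_superset (Iio_mem_nhds (by norm_num : (0:ℝ) < 1)) hmgf)
    rw [frequently_iff_seq_forall] at hfr ⊢
    obtain ⟨xs, hx, hxe⟩ := hfr
    refine ⟨fun n => xs n, ?_, fun n => ?_⟩
    · rw [tendsto_nhdsWithin_iff] at hx ⊢
      constructor
      · simpa [Function.comp_def] using (Complex.continuous_ofReal.tendsto 0).comp hx.1
      · simpa using hx.2
    · rw [complexMGF_ofReal, complexMGF_ofReal, hxe n]
  have hμ : μ₁ = μ₂ := by
    refine Measure.ext_of_charFun (funext fun t => ?_)
    rw [← complexMGF_id_mul_I, ← complexMGF_id_mul_I]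
    exact hEq (by simp)
  rw [withDensity_eq_iff_of_sigmaFinite hpm.ennreal_ofReal hmm.ennreal_ofReal] at hμ
  filter_upwards [hμ] with x hx
  have h1 : p x = m x := by
    simpa [ENNReal.toReal_ofReal (hp0 x), ENNReal.toReal_ofReal (hm0 x)] using
      congrArg ENNReal.toReal hx
  have h2 : G x = 0 := by
    simp only [p, m] at h1
    rcases le_total (G x) 0 with h | h
    · rw [max_eq_right h, max_eq_left (by linarith)] at h1; linarith
    · rw [max_eq_left h, max_eq_right (by linarith)] at h1; linarith
  simpa [hG] using h2

theorem aestronglyMeasurable_of_exp_mul {F : ℝ → ℝ} {s : ℝ}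
    (hint : IntegrableOn (fun x => Real.exp (-(s * x)) * F x) (Ioi 0)) :
    AEStronglyMeasurable F (volume.restrict (Ioi 0)) := by
  have h := (show Continuous fun x : ℝ => Real.exp (s * x) by
    fun_prop).aestronglyMeasurable.mul hint.aestronglyMeasurable
  refine h.congr (ae_of_all _ fun x => ?_)
  simp [← mul_assoc, ← Real.exp_add]

theorem intervalIntegrable_of_exp_mul {F : ℝ → ℝ} {s : ℝ}
    (hint : IntegrableOn (fun x => Real.exp (-(s * x)) * F x) (Ioi 0)) {x : ℝ} (hx : 0 ≤ x) :
    IntervalIntegrable F volume 0 x := by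
  have h : IntegrableOn (fun x => Real.exp (-(s * x)) * F x) (Ioc 0 x) :=
    hint.mono_set Ioc_subset_Ioi_self
  have h' := ((intervalIntegrable_iff_integrableOn_Ioc_of_le hx).2 h).continuousOn_mul
    (show Continuous fun x : ℝ => Real.exp (s * x) by fun_prop).continuousOn
  simpa [← mul_assoc, ← Real.exp_add] using h'

theorem continuousOn_laplace {F : ℝ → ℝ}
    (hint : ∀ s ∈ Ioi (0:ℝ), IntegrableOn (fun x => Real.exp (-(s * x)) * F x) (Ioi 0)) :
    ContinuousOn (fun s => ∫ x in Ioi (0:ℝ), Real.exp (-(s * x)) * F x) (Ioi 0) := by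
  intro s hs
  have hs : 0 < s := hs
  refine ContinuousAt.continuousWithinAt ?_
  refine continuousAt_of_dominated (bound := fun x => ‖Real.exp (-((s / 2) * x)) * F x‖)
    ?_ ?_ (hint (s / 2) (half_pos hs)).norm ?_
  · filter_upwards [Ioi_mem_nhds hs] with t ht using (hint t ht).aestronglyMeasurable
  · filter_upwards [Ioi_mem_nhds (half_lt_self hs)] with t ht
    refine (ae_restrict_iff' measurableSet_Ioi).2 (ae_of_all _ fun x (hx : 0 < x) => ?_)
    rw [norm_mul, norm_mul, Real.norm_of_nonneg (Real.exp_pos _).le,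
      Real.norm_of_nonneg (Real.exp_pos _).le]
    gcongr
    exact ht.le
  · exact ae_of_all _ fun x => by fun_prop

/-- The Laplace transform at `s` of the primitive of `u` is `1 / s` times that of `u`. -/
theorem laplace_primitive {u : ℝ → ℝ} {s : ℝ} (hs : 0 < s)
    (hint : IntegrableOn (fun x => Real.exp (-(s * x)) * u x) (Ioi 0)) :
    IntegrableOn (fun x => Real.exp (-(s * x)) * ∫ t in (0:ℝ)..x, u t) (Ioi 0) ∧
      s * ∫ x in Ioi (0:ℝ), Real.exp (-(s * x)) * ∫ t in (0:ℝ)..x, u t =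
        ∫ x in Ioi (0:ℝ), Real.exp (-(s * x)) * u x := by
  set ν := volume.restrict (Ioi (0:ℝ)) with hν
  let f : ℝ × ℝ → ℝ := {p : ℝ × ℝ | p.2 ≤ p.1}.indicator fun p => Real.exp (-(s * p.1)) * u p.2
  have hfm : AEStronglyMeasurable f (ν.prod ν) := by
    refine AEStronglyMeasurable.indicator ?_ (measurableSet_le measurable_snd measurable_fst)
    exact (show Continuous fun p : ℝ × ℝ => Real.exp (-(s * p.1)) by
      fun_prop).aestronglyMeasurable.mul (aestronglyMeasurable_of_exp_mul hint).comp_snd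
  have hft : ∀ t, (fun x => f (x, t)) =
      (Ici t).indicator fun x => Real.exp (-s * x) * u t := by
    intro t
    ext x
    simp [f, indicator_apply]
  have hexp : ∀ t ∈ Ioi (0:ℝ), ∀ v : ℝ,
      ∫ x, (Ici t).indicator (fun x => Real.exp (-s * x) * v) x ∂ν
        = s⁻¹ * (Real.exp (-(s * t)) * v) := by
    intro t ht v
    rw [integral_indicator measurableSet_Ici, hν, Measure.restrict_restrict measurableSet_Ici,
      inter_eq_left.2 (Ici_subset_Ioi.2 ht), integral_Ici_eq_integral_Ioi, integral_mul_const,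
      integral_exp_mul_Ioi (by linarith)]
    field_simp
  have hfi : Integrable f (ν.prod ν) := by
    refine (integrable_prod_iff' hfm).2 ⟨?_, ?_⟩
    · refine (ae_restrict_iff' measurableSet_Ioi).2 (ae_of_all _ fun t ht => ?_)
      rw [hft, integrable_indicator_iff measurableSet_Ici]
      refine Integrable.mul_const ?_ _
      exact (integrableOn_exp_mul_Ioi (by linarith) 0).integrable.mono_measure
        Measure.restrict_le_self
    · refine (hint.norm.const_mul s⁻¹).congr ?_
      refine (ae_restrict_iff' measurableSet_Ioi).2 (ae_of_all _ fun t ht => ?_)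
      have h1 : (fun x => ‖f (x, t)‖) =
          (Ici t).indicator fun x => Real.exp (-s * x) * ‖u t‖ := by
        ext x
        by_cases htx : t ≤ x <;> simp [f, htx]
      simp only [h1, hexp t ht]
      simp
  have hfx : ∀ᵐ x ∂ν, ∫ t, f (x, t) ∂ν = Real.exp (-(s * x)) * ∫ t in (0:ℝ)..x, u t := by
    refine (ae_restrict_iff' measurableSet_Ioi).2 (ae_of_all _ fun x (hx : 0 < x) => ?_)
    have h1 : (fun t => f (x, t)) =
        (Iic x).indicator fun t => Real.exp (-(s * x)) * u t := by
      ext t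
      simp [f, indicator_apply]
    rw [h1, integral_indicator measurableSet_Iic, hν,
      Measure.restrict_restrict measurableSet_Iic, Iic_inter_Ioi,
      intervalIntegral.integral_of_le hx.le, integral_const_mul]
  refine ⟨hfi.integral_prod_left.congr hfx, ?_⟩
  rw [← integral_congr_ae hfx, integral_integral_swap (f := fun x t => f (x, t)) hfi]
  have : ∀ᵐ t ∂ν, ∫ x, f (x, t) ∂ν = s⁻¹ * (Real.exp (-(s * t)) * u t) := by
    refine (ae_restrict_iff' measurableSet_Ioi).2 (ae_of_all _ fun t ht => ?_)
    rw [hft, hexp t ht]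
  rw [integral_congr_ae this, integral_const_mul, mul_inv_cancel_left₀ hs.ne']

/-- If `K h` and `c g / x + g'` have the same Laplace transform, the derivative being understood
through the transform, then `x ^ c * g x` is the primitive of `K x ^ c h x`. -/
theorem rpow_mul_eq_integral_of_laplace {g h : ℝ → ℝ} {c K : ℝ} (hc : 0 ≤ c)
    (hgc : ContinuousOn g (Ioi 0)) (hhc : ContinuousOn h (Ioi 0))
    (hg : ∀ s ∈ Ioi (0:ℝ), IntegrableOn (fun x => Real.exp (-(s * x)) * g x) (Ioi 0))
    (hgx : ∀ s ∈ Ioi (0:ℝ), IntegrableOn (fun x => Real.exp (-(s * x)) * (g x / x)) (Ioi 0))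
    (hh : ∀ s ∈ Ioi (0:ℝ), IntegrableOn (fun x => Real.exp (-(s * x)) * h x) (Ioi 0))
    (hlim : Tendsto (fun x => x ^ c * g x) (nhdsWithin 0 (Ioi 0)) (nhds 0))
    (heq : ∀ s ∈ Ioi (0:ℝ), K * ∫ x in Ioi (0:ℝ), Real.exp (-(s * x)) * h x =
      c * (∫ x in Ioi (0:ℝ), Real.exp (-(s * x)) * (g x / x)) +
        s * ∫ x in Ioi (0:ℝ), Real.exp (-(s * x)) * g x) :
    ∀ x ∈ Ioi (0:ℝ), x ^ c * g x = K * ∫ ξ in Ioo (0:ℝ) x, ξ ^ c * h ξ := by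
  set u : ℝ → ℝ := fun x => K * h x - c * (g x / x) with hu
  have huc : ContinuousOn u (Ioi 0) :=
    (hhc.const_mul K).sub ((hgc.div continuousOn_id fun x hx => (ne_of_gt hx)).const_mul c)
  have hue : ∀ s, (fun x => Real.exp (-(s * x)) * u x) = fun x =>
      K * (Real.exp (-(s * x)) * h x) - c * (Real.exp (-(s * x)) * (g x / x)) := by
    intro s
    ext x
    simp only [hu]
    ring
  have hui : ∀ s ∈ Ioi (0:ℝ), IntegrableOn (fun x => Real.exp (-(s * x)) * u x) (Ioi 0) := by
    intro s hs
    rw [hue]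
    exact ((hh s hs).const_mul K).sub ((hgx s hs).const_mul c)
  have hder : ∀ x ∈ Ioi (0:ℝ), HasDerivAt (fun y => ∫ t in (0:ℝ)..y, u t) (u x) x := by
    intro x hx
    exact intervalIntegral.integral_hasDerivAt_right
      (intervalIntegrable_of_exp_mul (hui 1 (mem_Ioi.2 one_pos)) (le_of_lt hx))
      (huc.stronglyMeasurableAtFilter isOpen_Ioi x hx) (huc.continuousAt (Ioi_mem_nhds hx))
  have hgU : EqOn g (fun y => ∫ t in (0:ℝ)..y, u t) (Ioi 0) := by
    refine Measure.eqOn_open_of_ae_eq (μ := volume) ?_ isOpen_Ioi hgc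
      fun x hx => (hder x hx).continuousAt.continuousWithinAt
    have hd : ∀ s, (fun x => Real.exp (-(s * x)) * (g x - ∫ t in (0:ℝ)..x, u t)) = fun x =>
        Real.exp (-(s * x)) * g x - Real.exp (-(s * x)) * ∫ t in (0:ℝ)..x, u t := by
      intro s; ext x; ring
    have h0 : (fun x => g x - ∫ t in (0:ℝ)..x, u t) =ᵐ[volume.restrict (Ioi 0)] 0 := by
      refine ae_eq_zero_of_laplace_eq_zero (fun s hs => ?_) fun s hs => ?_
      · rw [hd]
        exact (hg s hs).sub (laplace_primitive hs (hui s hs)).1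
      · have h1 := laplace_primitive hs (hui s hs)
        rw [hd, integral_sub (hg s hs) h1.1]
        have h2 := h1.2
        rw [hue, integral_sub ((hh s hs).const_mul K) ((hgx s hs).const_mul c),
          integral_const_mul, integral_const_mul, heq s hs] at h2
        exact mul_left_cancel₀ (ne_of_gt hs) (by linarith)
    filter_upwards [h0] with x hx using sub_eq_zero.1 hx
  have hgd : ∀ x ∈ Ioi (0:ℝ), HasDerivAt (fun y => y ^ c * g y) (K * (x ^ c * h x)) x := by
    intro x hx
    have hx' : 0 < x := hx
    have h1 : HasDerivAt g (u x) x :=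
      (hder x hx).congr_of_eventuallyEq (hgU.eventuallyEq_of_mem (Ioi_mem_nhds hx))
    refine ((Real.hasDerivAt_rpow_const (p := c) (Or.inl hx'.ne')).mul h1).congr_deriv ?_
    rw [hu, Real.rpow_sub_one hx'.ne']
    field_simp
    ring
  intro x hx
  have hx' : 0 < x := hx
  have hi : IntervalIntegrable (fun ξ => K * (ξ ^ c * h ξ)) volume 0 x :=
    ((intervalIntegrable_of_exp_mul (hh 1 (mem_Ioi.2 one_pos)) hx'.le).continuousOn_mul
      (Real.continuous_rpow_const hc).continuousOn).const_mul K
  have h2 := intervalIntegral.integral_eq_sub_of_hasDerivAt_of_tendsto hx'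
    (fun y hy => hgd y hy.1) hi hlim ((hgd x hx).continuousAt.tendsto.mono_left nhdsWithin_le_nhds)
  rw [sub_zero, intervalIntegral.integral_const_mul, intervalIntegral.integral_of_le hx'.le,
    integral_Ioc_eq_integral_Ioo] at h2
  exact h2.symm

theorem eq_withDensity_restrict_of_ae_mem {μ ν : Measure ℝ} {f : ℝ → ℝ≥0∞} {s : Set ℝ}
    (hs : MeasurableSet s) (h : μ = ν.withDensity f) (hmem : ∀ᵐ x ∂μ, x ∈ s) :
    μ = (ν.restrict s).withDensity f := by
  rw [← restrict_withDensity hs, ← h, Measure.restrict_eq_self_of_ae_mem hmem]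

theorem lintegral_Ioi_eq_lintegral_Ioo_ratio {x : ℝ} (hx : 0 < x) (φ : ℝ → ℝ≥0∞) :
    ∫⁻ y in Ioi 0, φ y =
      ∫⁻ z in Ioo (0:ℝ) 1, ENNReal.ofReal (x / z ^ 2) * φ ((1 - z) / z * x) := by
  have himg : (fun z : ℝ => (1 - z) / z * x) '' Ioo (0:ℝ) 1 = Ioi 0 := by
    ext y
    constructor
    · rintro ⟨z, hz, rfl⟩
      exact mul_pos (div_pos (sub_pos.2 hz.2) hz.1) hx
    · intro (hy : 0 < y)
      refine ⟨x / (x + y), ⟨by positivity, (div_lt_one (by positivity)).2 (by linarith)⟩, ?_⟩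
      have : x + y ≠ 0 := by positivity
      field_simp
      ring
  have hder : ∀ z ∈ Ioo (0:ℝ) 1,
      HasDerivWithinAt (fun z : ℝ => (1 - z) / z * x) (-(x / z ^ 2)) (Ioo 0 1) z := by
    intro z hz
    have hz0 : z ≠ 0 := hz.1.ne'
    have h := ((((hasDerivAt_id z).const_sub 1).div (hasDerivAt_id z) hz0).mul_const x)
    refine (h.congr_deriv ?_).hasDerivWithinAt
    simp only [id]
    field_simp
    ring
  have hinj : InjOn (fun z : ℝ => (1 - z) / z * x) (Ioo 0 1) := by
    intro z hz w hw h
    have h1 : (1 - z) / z = (1 - w) / w := mul_right_cancel₀ hx.ne' h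
    rw [div_eq_div_iff hz.1.ne' hw.1.ne'] at h1
    linarith
  rw [← himg, lintegral_image_eq_lintegral_abs_deriv_mul measurableSet_Ioo hder hinj]
  refine setLIntegral_congr_fun measurableSet_Ioo fun z hz => ?_
  simp only [abs_neg, abs_of_nonneg (div_nonneg hx.le (sq_nonneg z))]

/-- The density of `X / (X + Y)` for independent positive `X` and `Y` with densities. -/
theorem map_div_add_eq_withDensity {Ω : Type*} [MeasurableSpace Ω] {P : Measure Ω}
    [IsProbabilityMeasure P] {X Y : Ω → ℝ} (hXm : Measurable X) (hYm : Measurable Y)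
    (hindep : IndepFun X Y P) {f g : ℝ → ℝ≥0∞} (hf : Measurable f) (hg : Measurable g)
    (hX : P.map X = (volume.restrict (Ioi 0)).withDensity f)
    (hY : P.map Y = (volume.restrict (Ioi 0)).withDensity g) :
    P.map (fun ω => X ω / (X ω + Y ω)) = (volume.restrict (Ioo 0 1)).withDensity fun z =>
      ∫⁻ x in Ioi (0:ℝ), f x * (ENNReal.ofReal (x / z ^ 2) * g ((1 - z) / z * x)) := by
  ext S hS
  have hT : Measurable fun p : ℝ × ℝ => p.1 / (p.1 + p.2) := by fun_prop
  have hprod := (indepFun_iff_map_prod_eq_prod_map_map hXm.aemeasurable hYm.aemeasurable).1 hindep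
  have : IsProbabilityMeasure (P.map X) := Measure.isProbabilityMeasure_map hXm.aemeasurable
  have : IsProbabilityMeasure (P.map Y) := Measure.isProbabilityMeasure_map hYm.aemeasurable
  have hcomp : P.map (fun ω => X ω / (X ω + Y ω)) =
      ((P.map X).prod (P.map Y)).map fun p : ℝ × ℝ => p.1 / (p.1 + p.2) := by
    rw [← hprod, Measure.map_map hT (hXm.prodMk hYm)]
    rfl
  have hsec : ∀ x ∈ Ioi (0:ℝ), (P.map Y) (Prod.mk x ⁻¹'
      ((fun p : ℝ × ℝ => p.1 / (p.1 + p.2)) ⁻¹' S)) =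
      ∫⁻ z in Ioo (0:ℝ) 1, S.indicator 1 z *
        (ENNReal.ofReal (x / z ^ 2) * g ((1 - z) / z * x)) := by
    intro x hx
    have hx : 0 < x := hx
    rw [hY, withDensity_apply _ (measurable_prodMk_left (hT hS)),
      ← lintegral_indicator (measurable_prodMk_left (hT hS)),
      lintegral_Ioi_eq_lintegral_Ioo_ratio hx]
    refine setLIntegral_congr_fun measurableSet_Ioo fun z hz => ?_
    have hz0 : z ≠ 0 := hz.1.ne'
    have hxz : x / (x + (1 - z) / z * x) = z := by
      have : x + (1 - z) / z * x = x / z := by field_simp; ring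
      rw [this]
      field_simp
    by_cases hzS : z ∈ S <;> simp [hxz, hzS]
  rw [hcomp, Measure.map_apply hT hS, Measure.prod_apply (hT hS)]
  nth_rewrite 1 [hX]
  rw [lintegral_withDensity_eq_lintegral_mul _ hf (measurable_measure_prodMk_left (hT hS)),
    withDensity_apply _ hS, ← lintegral_indicator hS]
  have hk : Measurable fun p : ℝ × ℝ =>
      ENNReal.ofReal (p.1 / p.2 ^ 2) * g ((1 - p.2) / p.2 * p.1) := by fun_prop
  have hi : Measurable (S.indicator (1 : ℝ → ℝ≥0∞)) := measurable_one.indicator hS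
  calc
    _ = ∫⁻ x in Ioi (0:ℝ), ∫⁻ z in Ioo (0:ℝ) 1, f x * (S.indicator 1 z *
        (ENNReal.ofReal (x / z ^ 2) * g ((1 - z) / z * x))) := by
      refine setLIntegral_congr_fun measurableSet_Ioi fun x hx => ?_
      simp only [Pi.mul_apply]
      rw [hsec x hx, lintegral_const_mul]
      exact hi.mul (hk.comp measurable_prodMk_left)
    _ = ∫⁻ z in Ioo (0:ℝ) 1, ∫⁻ x in Ioi (0:ℝ), f x * (S.indicator 1 z *
        (ENNReal.ofReal (x / z ^ 2) * g ((1 - z) / z * x))) := by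
      refine lintegral_lintegral_swap (Measurable.aemeasurable ?_)
      exact (hf.comp measurable_fst).mul ((hi.comp measurable_snd).mul hk)
    _ = _ := by
      refine lintegral_congr fun z => ?_
      by_cases hzS : z ∈ S <;> simp [hzS]

theorem theorem_two_inverse_laplace
    {Ω : Type*} [MeasurableSpace Ω] (P : Measure Ω) [IsProbabilityMeasure P]
    (X Y : Ω → ℝ) (hXm : Measurable X) (hYm : Measurable Y)
    (hindep : IndepFun X Y P)
    (hXpos : ∀ᵐ ω ∂P, 0 < X ω) (hYpos : ∀ᵐ ω ∂P, 0 < Y ω)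
    (fX fY fZ A B : ℝ → ℝ)
    (hfXm : Measurable fX) (hfYm : Measurable fY) (hfZm : Measurable fZ)
    (hfX0 : ∀ x, 0 ≤ fX x) (hfY0 : ∀ y, 0 ≤ fY y) (hfZ0 : ∀ z, 0 ≤ fZ z)
    (hX : P.map X = volume.withDensity (fun x => ENNReal.ofReal (fX x)))
    (hY : P.map Y = volume.withDensity (fun y => ENNReal.ofReal (fY y)))
    (hZ : P.map (fun ω => X ω / (X ω + Y ω)) =
      (volume.restrict (Ioo 0 1)).withDensity (fun z => ENNReal.ofReal (fZ z)))
    (q lam p : ℝ) (hq : 0 < q) (hlam : 0 < lam) (hp : 0 ≤ p)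
    (hA : ∀ s ∈ Ioi (0:ℝ), 0 < A s) (hB : ∀ x ∈ Ioi (0:ℝ), 0 < B x)
    (hAc : ContinuousOn A (Ioi 0)) (hBc : ContinuousOn B (Ioi 0))
    (hfXc : ContinuousOn fX (Ioi 0))
    (hdecomp : ∀ s ∈ Ioi (0:ℝ), ∀ x ∈ Ioi (0:ℝ),
      fY (s * x) = A s * B x * (p + q * s * x) * Real.exp (-(lam * s * x)))
    (hlim : Tendsto (fun x => x ^ (lam * p / q + 2) * B x * fX x)
      (nhdsWithin 0 (Ioi 0)) (nhds 0))
    (h : ℝ → ℝ) (hhc : ContinuousOn h (Ioi 0))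
    (hLaplace : ∀ s ∈ Ioi (0:ℝ),
      IntegrableOn (fun ξ => Real.exp (-(s * ξ)) * h ξ) (Ioi 0) volume ∧
      ∫ ξ in Ioi (0:ℝ), Real.exp (-(s * ξ)) * h ξ =
        (1 / (A (s / lam) * (s + lam) ^ 2)) * fZ (lam / (s + lam)))
    (hInt1 : ∀ s ∈ Ioi (0:ℝ),
      IntegrableOn (fun x => x * B x * fX x * Real.exp (-(s * x))) (Ioi 0) volume)
    (hInt2 : ∀ s ∈ Ioi (0:ℝ),
      IntegrableOn (fun x => x ^ 2 * B x * fX x * Real.exp (-(s * x))) (Ioi 0) volume) :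
    ∀ x ∈ Ioi (0:ℝ), fX x =
      (lam ^ 3 / (q * x ^ (lam * p / q + 2) * B x)) *
        ∫ ξ in Ioo (0:ℝ) x, ξ ^ (lam * p / q) * h ξ := by
  set c : ℝ := lam * p / q with hc
  set g : ℝ → ℝ := fun x => x ^ 2 * B x * fX x with hg
  have hgx : ∀ s ∈ Ioi (0:ℝ),
      IntegrableOn (fun x => Real.exp (-(s * x)) * (g x / x)) (Ioi 0) := by
    intro s hs
    refine (hInt1 s hs).congr_fun (fun x hx => ?_) measurableSet_Ioi
    have hx : x ≠ 0 := ne_of_gt hx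
    simp only [hg]
    field_simp
  have hgi : ∀ s ∈ Ioi (0:ℝ), IntegrableOn (fun x => Real.exp (-(s * x)) * g x) (Ioi 0) := by
    intro s hs
    refine (hInt2 s hs).congr_fun (fun x hx => ?_) measurableSet_Ioi
    simp only [hg]
    ring
  have hhi : ∀ s ∈ Ioi (0:ℝ), IntegrableOn (fun x => Real.exp (-(s * x)) * h x) (Ioi 0) :=
    fun s hs => (hLaplace s hs).1
  have hpow : ∀ x ∈ Ioi (0:ℝ), x ^ c * g x = x ^ (c + 2) * B x * fX x := by
    intro x hx
    rw [Real.rpow_add hx, Real.rpow_two]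
    simp only [hg]
    ring
  set D1 : ℝ → ℝ := fun s => ∫ x in Ioi (0:ℝ), Real.exp (-(s * x)) * (g x / x)
  set D2 : ℝ → ℝ := fun s => ∫ x in Ioi (0:ℝ), Real.exp (-(s * x)) * g x
  set H : ℝ → ℝ := fun s => ∫ x in Ioi (0:ℝ), Real.exp (-(s * x)) * h x with hH
  have hw : ∀ z ∈ Ioo (0:ℝ) 1, 0 < (1 - z) / z := fun z hz => div_pos (sub_pos.2 hz.2) hz.1
  have hs : ∀ z ∈ Ioo (0:ℝ) 1, 0 < lam * ((1 - z) / z) := fun z hz => mul_pos hlam (hw z hz)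
  have hXmem : ∀ᵐ x ∂(P.map X), x ∈ Ioi (0:ℝ) :=
    (ae_map_iff hXm.aemeasurable measurableSet_Ioi).2 hXpos
  have hYmem : ∀ᵐ x ∂(P.map Y), x ∈ Ioi (0:ℝ) :=
    (ae_map_iff hYm.aemeasurable measurableSet_Ioi).2 hYpos
  have hdens := map_div_add_eq_withDensity hXm hYm hindep hfXm.ennreal_ofReal
    hfYm.ennreal_ofReal (eq_withDensity_restrict_of_ae_mem measurableSet_Ioi hX hXmem)
    (eq_withDensity_restrict_of_ae_mem measurableSet_Ioi hY hYmem)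
  have hmeas : Measurable fun z : ℝ => ∫⁻ x in Ioi (0:ℝ), ENNReal.ofReal (fX x) *
      (ENNReal.ofReal (x / z ^ 2) * ENNReal.ofReal (fY ((1 - z) / z * x))) := by
    refine Measurable.lintegral_prod_right' (f := fun r : ℝ × ℝ => ENNReal.ofReal (fX r.2) *
      (ENNReal.ofReal (r.2 / r.1 ^ 2) * ENNReal.ofReal (fY ((1 - r.1) / r.1 * r.2)))) ?_
    fun_prop
  rw [hZ, withDensity_eq_iff_of_sigmaFinite hfZm.ennreal_ofReal.aemeasurable
    hmeas.aemeasurable] at hdens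
  have hfZ : ∀ᵐ z ∂(volume.restrict (Ioo (0:ℝ) 1)), fZ z = A ((1 - z) / z) / z ^ 2 *
      (p * D1 (lam * ((1 - z) / z)) + q * ((1 - z) / z) * D2 (lam * ((1 - z) / z))) := by
    filter_upwards [hdens, ae_restrict_mem measurableSet_Ioo] with z hz hz1
    have hi := (((hgx _ (hs z hz1)).const_mul p).add
      ((hgi _ (hs z hz1)).const_mul (q * ((1 - z) / z)))).const_mul (A ((1 - z) / z) / z ^ 2)
    have hval : ∫ x in Ioi (0:ℝ), A ((1 - z) / z) / z ^ 2 *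
        (p * (Real.exp (-(lam * ((1 - z) / z) * x)) * (g x / x)) +
          q * ((1 - z) / z) * (Real.exp (-(lam * ((1 - z) / z) * x)) * g x)) =
        A ((1 - z) / z) / z ^ 2 *
      (p * D1 (lam * ((1 - z) / z)) + q * ((1 - z) / z) * D2 (lam * ((1 - z) / z))) := by
      rw [integral_const_mul, integral_add ((hgx _ (hs z hz1)).const_mul p)
        ((hgi _ (hs z hz1)).const_mul _), integral_const_mul, integral_const_mul]
    have hform : ∀ x ∈ Ioi (0:ℝ), A ((1 - z) / z) / z ^ 2 *
        (p * (Real.exp (-(lam * ((1 - z) / z) * x)) * (g x / x)) +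
          q * ((1 - z) / z) * (Real.exp (-(lam * ((1 - z) / z) * x)) * g x)) =
        fX x * (x / z ^ 2 * fY ((1 - z) / z * x)) := by
      intro x hx
      have hx0 : x ≠ 0 := ne_of_gt hx
      have hz0 : z ≠ 0 := hz1.1.ne'
      rw [hdecomp _ (hw z hz1) x hx]
      simp only [hg]
      field_simp
    have hnn : ∀ x ∈ Ioi (0:ℝ), 0 ≤ fX x * (x / z ^ 2 * fY ((1 - z) / z * x)) := by
      intro x hx
      exact mul_nonneg (hfX0 x)
        (mul_nonneg (div_nonneg (le_of_lt hx) (sq_nonneg z)) (hfY0 _))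
    have hint0 : 0 ≤ ∫ x in Ioi (0:ℝ), fX x * (x / z ^ 2 * fY ((1 - z) / z * x)) :=
      setIntegral_nonneg measurableSet_Ioi hnn
    have hi' : IntegrableOn (fun x => fX x * (x / z ^ 2 * fY ((1 - z) / z * x))) (Ioi 0) :=
      IntegrableOn.congr_fun hi hform measurableSet_Ioi
    rw [← hval, setIntegral_congr_fun measurableSet_Ioi hform]
    refine (ENNReal.ofReal_eq_ofReal_iff (hfZ0 z) hint0).1 ?_
    rw [hz, ofReal_integral_eq_lintegral_ofReal hi'
      ((ae_restrict_iff' measurableSet_Ioi).2 (ae_of_all _ hnn))]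
    refine setLIntegral_congr_fun measurableSet_Ioi fun x hx => ?_
    rw [ENNReal.ofReal_mul (hfX0 x), ENNReal.ofReal_mul (div_nonneg (le_of_lt hx) (sq_nonneg z))]
  have hfZH : ∀ z ∈ Ioo (0:ℝ) 1, fZ z =
      A ((1 - z) / z) / z ^ 2 * (lam ^ 2 * H (lam * ((1 - z) / z))) := by
    intro z hz
    have hz0 : z ≠ 0 := hz.1.ne'
    have h1 := (hLaplace _ (hs z hz)).2
    have hA0 : A ((1 - z) / z) ≠ 0 := (hA _ (hw z hz)).ne'
    have h2 : lam * ((1 - z) / z) + lam = lam / z := by field_simp; ring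
    rw [mul_div_cancel_left₀ _ hlam.ne', h2, div_div_cancel₀ hlam.ne'] at h1
    simp only [hH]
    rw [h1]
    field_simp
  have hwc : ContinuousOn (fun z : ℝ => (1 - z) / z) (Ioo 0 1) :=
    (by fun_prop : Continuous fun z : ℝ => 1 - z).continuousOn.div continuousOn_id
      fun z hz => hz.1.ne'
  have hsc : ContinuousOn (fun z : ℝ => lam * ((1 - z) / z)) (Ioo 0 1) := hwc.const_mul lam
  have hAzc : ContinuousOn (fun z : ℝ => A ((1 - z) / z) / z ^ 2) (Ioo 0 1) :=
    (hAc.comp hwc hw).div (continuousOn_id.pow 2) fun z hz => pow_ne_zero 2 hz.1.ne'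
  have hEq : EqOn (fun z => A ((1 - z) / z) / z ^ 2 * (lam ^ 2 * H (lam * ((1 - z) / z))))
      (fun z => A ((1 - z) / z) / z ^ 2 *
        (p * D1 (lam * ((1 - z) / z)) + q * ((1 - z) / z) * D2 (lam * ((1 - z) / z))))
      (Ioo 0 1) := by
    refine Measure.eqOn_open_of_ae_eq (μ := volume) ?_ isOpen_Ioo
      (hAzc.mul (((continuousOn_laplace hhi).comp hsc hs).const_mul _))
      (hAzc.mul ((((continuousOn_laplace hgx).comp hsc hs).const_mul p).add
        ((hwc.const_mul q).mul ((continuousOn_laplace hgi).comp hsc hs))))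
    filter_upwards [hfZ, ae_restrict_mem measurableSet_Ioo] with z hz hz1
    rw [← hfZH z hz1, hz]
  have heq : ∀ s ∈ Ioi (0:ℝ), lam ^ 3 / q * H s = c * D1 s + s * D2 s := by
    intro s hs0
    have hs0 : 0 < s := hs0
    have hz : lam / (s + lam) ∈ Ioo (0:ℝ) 1 :=
      ⟨by positivity, (div_lt_one (by positivity)).2 (by linarith)⟩
    have h1 := hEq hz
    have h2 : (1 - lam / (s + lam)) / (lam / (s + lam)) = s / lam := by
      have : s + lam ≠ 0 := by positivity
      field_simp
      ring
    have h3 : A (s / lam) / (lam / (s + lam)) ^ 2 ≠ 0 :=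
      div_ne_zero (hA _ (div_pos hs0 hlam)).ne' (pow_ne_zero 2 hz.1.ne')
    simp only [h2, mul_div_cancel₀ s hlam.ne'] at h1
    have h4 := mul_left_cancel₀ h3 h1
    calc
      lam ^ 3 / q * H s = lam / q * (lam ^ 2 * H s) := by ring
      _ = c * D1 s + s * D2 s := by rw [h4, hc]; field_simp
  intro x hx
  have hx0 : 0 < x := hx
  have hmain := rpow_mul_eq_integral_of_laplace (g := g) (by positivity : 0 ≤ c)
    (((continuousOn_id.pow 2).mul hBc).mul hfXc) hhc hgi hgx hhi
    (hlim.congr' (by filter_upwards [self_mem_nhdsWithin] with y hy using (hpow y hy).symm))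
    heq x hx
  rw [hpow x hx] at hmain
  have hB0 : B x ≠ 0 := (hB x hx).ne'
  have hxc : x ^ (c + 2) ≠ 0 := (Real.rpow_pos_of_pos hx0 _).ne'
  calc
    fX x = x ^ (c + 2) * B x * fX x / (x ^ (c + 2) * B x) := by field_simp
    _ = _ := by rw [hmain]; field_simp
end

section
/- Let β > 0, λ > 0 and let v be a positive integer. Define the confluent hypergeometric function ₁F₁(a;c;w) = Σ_{n=0}^∞ ((a)_n/(c)_n) * (w^n/n!), where (x)_n is the ascending factorial. Let X and Y be independent random variables on a probability space, each almost surely positive, where X has Lebesgue density f_X(x) = 2*v*Γ(β) * Σ_{k=0}^{v-1} C(v-1,k) * 2^k * λ^{2v-k-1} * x^{2v-k-2} * ₁F₁(2v+1; β+2v-k-1; -λ*x) / Γ(β+2v-k-1) for x > 0 (assumed nonnegative), and Y has the Gamma(β,λ) density f_Y(y) = λ^β * y^{β-1} * exp(-λ*y) / Γ(β). Then Z = X/(X+Y) has the Topp–Leone density f_Z(z) = 2*v * z^{v-1} * (1-z) * (2-z)^{v-1} for z ∈ (0,1). -/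
open MeasureTheory ProbabilityTheory Real Set

/-- The confluent hypergeometric function ₁F₁(a; c; w), defined by its power series,
where the Pochhammer (ascending factorial) symbol (x)ₙ = x(x+1)⋯(x+n-1). -/
noncomputable def oneFOne (a c w : ℝ) : ℝ :=
  ∑' n : ℕ, ((∏ i ∈ Finset.range n, (a + (i : ℝ))) /
    (∏ i ∈ Finset.range n, (c + (i : ℝ)))) * w ^ n / (n.factorial : ℝ)

lemma Gamma_add_natCast {c : ℝ} (hc : 0 < c) (n : ℕ) :
    Real.Gamma (c + n) = Real.Gamma c * ∏ i ∈ Finset.range n, (c + (i : ℝ)) := by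
  induction n with
  | zero => simp
  | succ n ih =>
    have : c + ((n + 1 : ℕ) : ℝ) = (c + n) + 1 := by push_cast; ring
    rw [this, Real.Gamma_add_one (by positivity), ih, Finset.prod_range_succ]
    ring

lemma prod_range_natCast_succ_add_div_factorial (m n : ℕ) :
    (∏ i ∈ Finset.range n, ((m : ℝ) + 1 + i)) / (n.factorial : ℝ) = ((n + m).choose m : ℝ) := by
  have h : (∏ i ∈ Finset.range n, ((m : ℝ) + 1 + i)) = ((m + 1).ascFactorial n : ℝ) := by
    rw [Nat.ascFactorial_eq_prod_range]
    push_cast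
    rfl
  rw [h, Nat.ascFactorial_eq_factorial_mul_choose, add_comm n m, Nat.choose_symm_add]
  push_cast
  field_simp

lemma measurable_oneFOne (a c : ℝ) : Measurable (oneFOne a c) := by
  unfold oneFOne
  exact Measurable.tsum fun n => by fun_prop

lemma integrableOn_rpow_mul_exp_neg_mul {c s : ℝ} (hc : 0 < c) (hs : 0 < s) :
    IntegrableOn (fun x : ℝ => x ^ (c - 1) * Real.exp (-(s * x))) (Ioi 0) := by
  have := integrableOn_rpow_mul_exp_neg_mul_rpow (p := 1) (s := c - 1) (b := s)
    (by linarith) one_pos hs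
  simpa using this

/-- Laplace transform of `x ^ (c - 1) * ₁F₁(m + 1; c; -lam * x)` at `s > lam`. -/
lemma integral_rpow_mul_exp_neg_mul_oneFOne {c lam s : ℝ} (hc : 0 < c) (hlam : 0 < lam)
    (hs : lam < s) (m : ℕ) :
    ∫ x in Ioi (0 : ℝ), x ^ (c - 1) * Real.exp (-(s * x)) *
      oneFOne ((m : ℝ) + 1) c (-(lam * x)) =
      Real.Gamma c * (1 / s) ^ c * (s / (s + lam)) ^ (m + 1) := by
  have hs0 : 0 < s := hlam.trans hs
  set A : ℕ → ℝ := fun n => ((∏ i ∈ Finset.range n, ((m : ℝ) + 1 + i)) /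
    (∏ i ∈ Finset.range n, (c + (i : ℝ)))) / (n.factorial : ℝ) with hA
  have hA0 (n : ℕ) : 0 ≤ A n := by
    have : 0 ≤ ∏ i ∈ Finset.range n, (c + (i : ℝ)) :=
      Finset.prod_nonneg fun i _ => by positivity
    positivity
  have hAG (n : ℕ) : A n * Real.Gamma (c + n) = ((n + m).choose m : ℝ) * Real.Gamma c := by
    have : ∏ i ∈ Finset.range n, (c + (i : ℝ)) ≠ 0 :=
      Finset.prod_ne_zero_iff.2 fun i _ => by positivity
    rw [Gamma_add_natCast hc, ← prod_range_natCast_succ_add_div_factorial]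
    simp only [hA]
    field_simp
  set F : ℕ → ℝ → ℝ := fun n x =>
    A n * (-lam) ^ n * (x ^ (c + n - 1) * Real.exp (-(s * x))) with hF
  have hFint (n : ℕ) : Integrable (F n) (volume.restrict (Ioi 0)) :=
    (integrableOn_rpow_mul_exp_neg_mul (c := c + n) (by positivity) hs0).const_mul _
  have hbase (n : ℕ) : ∫ x in Ioi (0 : ℝ), x ^ (c + n - 1) * Real.exp (-(s * x)) =
      (1 / s) ^ c * (1 / s) ^ n * Real.Gamma (c + n) := by
    rw [integral_rpow_mul_exp_neg_mul_Ioi (by positivity) hs0,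
      Real.rpow_add (by positivity), Real.rpow_natCast]
  have hFval (n : ℕ) : ∫ x in Ioi (0 : ℝ), F n x =
      Real.Gamma c * (1 / s) ^ c * (((n + m).choose m : ℝ) * (-lam / s) ^ n) := by
    rw [integral_const_mul, hbase]
    calc _ = (A n * Real.Gamma (c + n)) * (1 / s) ^ c * ((-lam) ^ n * (1 / s) ^ n) := by ring
      _ = _ := by rw [hAG, ← mul_pow]; ring
  have hFnorm (n : ℕ) : ∫ x in Ioi (0 : ℝ), ‖F n x‖ =
      Real.Gamma c * (1 / s) ^ c * (((n + m).choose m : ℝ) * (lam / s) ^ n) := by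
    have : ∀ x ∈ Ioi (0 : ℝ), ‖F n x‖ =
        A n * lam ^ n * (x ^ (c + n - 1) * Real.exp (-(s * x))) := fun x hx => by
      have hx' : 0 < x := hx
      simp only [hF, norm_mul, norm_pow, norm_neg, Real.norm_of_nonneg (hA0 n),
        Real.norm_of_nonneg hlam.le, Real.norm_of_nonneg (Real.rpow_nonneg hx'.le _),
        Real.norm_of_nonneg (Real.exp_nonneg _)]
    rw [setIntegral_congr_fun measurableSet_Ioi this, integral_const_mul, hbase]
    calc _ = (A n * Real.Gamma (c + n)) * (1 / s) ^ c * (lam ^ n * (1 / s) ^ n) := by ring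
      _ = _ := by rw [hAG, ← mul_pow]; ring
  have hr : ‖lam / s‖ < 1 := by
    rw [Real.norm_of_nonneg (by positivity)]
    exact (div_lt_one hs0).2 hs
  have hr' : ‖-lam / s‖ < 1 := by rwa [neg_div, norm_neg]
  have key := hasSum_integral_of_summable_integral_norm hFint (by
    simp_rw [hFnorm]
    exact (hasSum_choose_mul_geometric_of_norm_lt_one m hr).summable.mul_left _)
  simp_rw [hFval] at key
  have h1 := key.unique ((hasSum_choose_mul_geometric_of_norm_lt_one m hr').mul_left _)
  calc _ = ∫ x in Ioi (0 : ℝ), ∑' n, F n x := by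
        refine setIntegral_congr_fun measurableSet_Ioi fun x hx => ?_
        have hx' : 0 < x := hx
        simp only [oneFOne]
        rw [← tsum_mul_left]
        refine tsum_congr fun n => ?_
        have : c + (n : ℝ) - 1 = (c - 1) + n := by ring
        simp only [hF, hA]
        rw [this, Real.rpow_add hx', Real.rpow_natCast, ← neg_mul lam x, mul_pow]
        ring
    _ = _ := h1
    _ = _ := by
        congr 1
        rw [← one_div_pow]
        congr 1
        rw [neg_div, sub_neg_eq_add, one_add_div hs0.ne', one_div_div]

lemma integrableOn_rpow_mul_exp_neg_mul_oneFOne {c lam s : ℝ} (hc : 0 < c) (hlam : 0 < lam)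
    (hs : lam < s) (m : ℕ) :
    IntegrableOn (fun x : ℝ => x ^ (c - 1) * Real.exp (-(s * x)) *
      oneFOne ((m : ℝ) + 1) c (-(lam * x))) (Ioi 0) := by
  refine not_imp_comm.1 integral_undef ?_
  rw [integral_rpow_mul_exp_neg_mul_oneFOne hc hlam hs]
  have hs0 : 0 < s := hlam.trans hs
  have := Real.Gamma_pos_of_pos hc
  positivity

lemma rpow_mul_exp_neg_mul_le {β s x : ℝ} (hβ : 0 < β) (hs : 0 < s) (hx : 0 < x) :
    x ^ β * Real.exp (-(s * x)) ≤ (β / s) ^ β := by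
  have h1 : s * x / β ≤ Real.exp (s * x / β) := by
    linarith [Real.add_one_le_exp (s * x / β)]
  have h2 := Real.rpow_le_rpow (by positivity) h1 hβ.le
  rw [← Real.exp_mul, div_mul_cancel₀ _ hβ.ne'] at h2
  have h3 : x ^ β = (β / s) ^ β * (s * x / β) ^ β := by
    rw [← Real.mul_rpow (by positivity) (by positivity)]
    congr 1
    field_simp
  calc _ = (β / s) ^ β * ((s * x / β) ^ β * Real.exp (-(s * x))) := by rw [h3]; ring
    _ ≤ (β / s) ^ β * (Real.exp (s * x) * Real.exp (-(s * x))) := by gcongr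
    _ = _ := by rw [← Real.exp_add]; simp

lemma integrable_rpow_mul_exp_neg_mul {μ : Measure ℝ} [IsFiniteMeasure μ]
    (hμ : ∀ᵐ x ∂μ, 0 < x) {β s : ℝ} (hβ : 0 < β) (hs : 0 < s) :
    Integrable (fun x => x ^ β * Real.exp (-(s * x))) μ := by
  refine Integrable.of_bound (by fun_prop) ((β / s) ^ β) ?_
  filter_upwards [hμ] with x hx
  rw [Real.norm_of_nonneg (by positivity)]
  exact rpow_mul_exp_neg_mul_le hβ hs hx

/-- The weighted Laplace transform of a finite measure on `(0, ∞)` is analytic on `(0, ∞)`. -/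
lemma analyticOnNhd_integral_rpow_mul_exp_neg_mul {μ : Measure ℝ} [IsFiniteMeasure μ]
    (hμ : ∀ᵐ x ∂μ, 0 < x) {β : ℝ} (hβ : 0 < β) :
    AnalyticOnNhd ℝ (fun s => ∫ x, x ^ β * Real.exp (-(s * x)) ∂μ) (Ioi 0) := by
  set ν := μ.withDensity fun x => ENNReal.ofReal (x ^ β)
  have hm : AEMeasurable (fun x : ℝ => ENNReal.ofReal (x ^ β)) μ := by fun_prop
  have hlt : ∀ᵐ x ∂μ, ENNReal.ofReal (x ^ β) < ⊤ := by simp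
  have hae (s : ℝ) : (fun x : ℝ => (ENNReal.ofReal (x ^ β)).toReal • Real.exp (s * -x)) =ᵐ[μ]
      fun x => x ^ β * Real.exp (-(s * x)) := by
    filter_upwards [hμ] with x hx
    rw [ENNReal.toReal_ofReal (by positivity), smul_eq_mul, mul_neg]
  have hmgf : (fun s => ∫ x, x ^ β * Real.exp (-(s * x)) ∂μ) = mgf (fun x => -x) ν := by
    ext s
    rw [mgf, integral_withDensity_eq_integral_toReal_smul₀ hm hlt]
    exact integral_congr_ae (hae s).symm
  rw [hmgf]
  refine analyticOnNhd_mgf.mono (interior_maximal (fun s hs => ?_) isOpen_Ioi)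
  change Integrable _ ν
  rw [integrable_withDensity_iff_integrable_smul₀' hm hlt, integrable_congr (hae s)]
  exact integrable_rpow_mul_exp_neg_mul hμ hβ hs

/-- The law of `x / (x + y)` when `x > 0` has law `μ` and `y > 0` has density `g`. -/
lemma map_div_add_prod_withDensity {μ : Measure ℝ} [IsFiniteMeasure μ]
    (hμ : ∀ᵐ x ∂μ, 0 < x) {g : ℝ → ENNReal} (hg : Measurable g) :
    (μ.prod ((volume.restrict (Ioi 0)).withDensity g)).map (fun p => p.1 / (p.1 + p.2)) =
      (volume.restrict (Ioo 0 1)).withDensity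
        (fun z => ∫⁻ x, ENNReal.ofReal (x / z ^ 2) * g (x * (1 / z - 1)) ∂μ) := by
  have hmeas : Measurable fun p : ℝ × ℝ => p.1 / (p.1 + p.2) := by fun_prop
  ext A hA
  rw [Measure.map_apply hmeas hA, Measure.prod_apply (hmeas hA), withDensity_apply _ hA]
  have hx : ∀ x : ℝ, 0 < x → ((volume.restrict (Ioi 0)).withDensity g)
      (Prod.mk x ⁻¹' ((fun p : ℝ × ℝ => p.1 / (p.1 + p.2)) ⁻¹' A)) =
      ∫⁻ z in Ioo (0 : ℝ) 1, A.indicator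
        (fun z => ENNReal.ofReal (x / z ^ 2) * g (x * (1 / z - 1))) z := by
    intro x hx
    have himg : (fun z : ℝ => x * (1 / z - 1)) '' Ioo 0 1 = Ioi 0 := by
      ext y
      simp only [mem_image, mem_Ioo, mem_Ioi]
      constructor
      · rintro ⟨z, ⟨h0, h1⟩, rfl⟩
        have := one_lt_one_div h0 h1
        exact mul_pos hx (by linarith)
      · intro hy
        refine ⟨x / (x + y), ⟨by positivity, (div_lt_one (by positivity)).2 (by linarith)⟩, ?_⟩
        field_simp
        ring
    have hS : MeasurableSet (Prod.mk x ⁻¹' ((fun p : ℝ × ℝ => p.1 / (p.1 + p.2)) ⁻¹' A)) :=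
      measurable_prodMk_left (hmeas hA)
    rw [withDensity_apply _ hS, ← lintegral_indicator hS, ← himg,
      lintegral_image_eq_lintegral_abs_deriv_mul measurableSet_Ioo
        (f' := fun z => -(x / z ^ 2)) (fun z hz => ?_) (fun z _ w _ h => ?_)]
    · refine setLIntegral_congr_fun measurableSet_Ioo fun z hz => ?_
      have hz0 : z ≠ 0 := hz.1.ne'
      have hmem : (x * (1 / z - 1) ∈
          (Prod.mk x ⁻¹' ((fun p : ℝ × ℝ => p.1 / (p.1 + p.2)) ⁻¹' A))) ↔ z ∈ A := by
        have : x / (x + x * (1 / z - 1)) = z := by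
          field_simp
          ring
        simp only [mem_preimage, this]
      rw [abs_neg, abs_of_nonneg (by positivity)]
      by_cases hzA : z ∈ A
      · rw [indicator_of_mem hzA, indicator_of_mem (hmem.2 hzA)]
      · rw [indicator_of_notMem hzA, indicator_of_notMem (mt hmem.1 hzA), mul_zero]
    · have := (((hasDerivAt_inv hz.1.ne').sub_const 1).const_mul x).hasDerivWithinAt (s := Ioo 0 1)
      simp only [one_div]
      exact this.congr_deriv (by ring)
    · have := mul_left_cancel₀ hx.ne' h
      simpa using this
  have hJ : Measurable (Function.uncurry fun (x z : ℝ) => A.indicator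
      (fun z => ENNReal.ofReal (x / z ^ 2) * g (x * (1 / z - 1))) z) := by
    have : (Function.uncurry fun (x z : ℝ) => A.indicator
      (fun z => ENNReal.ofReal (x / z ^ 2) * g (x * (1 / z - 1))) z) =
      (Prod.snd ⁻¹' A).indicator (fun p : ℝ × ℝ =>
        ENNReal.ofReal (p.1 / p.2 ^ 2) * g (p.1 * (1 / p.2 - 1))) := by
      rfl
    rw [this]
    exact Measurable.indicator (by fun_prop) (measurable_snd hA)
  rw [lintegral_congr_ae (hμ.mono hx), lintegral_lintegral_swap hJ.aemeasurable,
    ← lintegral_indicator hA]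
  refine lintegral_congr fun z => ?_
  by_cases hz : z ∈ A <;> simp [hz]

/-- The closed form, for every `s > 0`, of the Laplace transform of `x ^ β` times the density
appearing in `topp_leone_ratio`. -/
noncomputable def weightedLaplace (β lam : ℝ) (v : ℕ) (s : ℝ) : ℝ :=
  2 * v * Real.Gamma β * lam ^ (2 * (v : ℝ) - 1) *
    (s ^ (2 - β) / (s + lam) ^ (2 * v + 1) * (1 + 2 * s / lam) ^ (v - 1))

lemma analyticOnNhd_weightedLaplace (β : ℝ) {lam : ℝ} (hlam : 0 < lam) (v : ℕ) :
    AnalyticOnNhd ℝ (weightedLaplace β lam v) (Ioi 0) := by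
  intro s hs
  have hs0 : 0 < s := hs
  have h1 : AnalyticAt ℝ (fun s : ℝ => s ^ (2 - β)) s := by
    refine (analyticAt_rexp.comp
      ((analyticAt_log hs0).mul (analyticAt_const (v := 2 - β)))).congr ?_
    filter_upwards [Ioi_mem_nhds hs0] with t ht
    exact (Real.rpow_def_of_pos ht _).symm
  have h2 : AnalyticAt ℝ (fun s : ℝ => (s + lam) ^ (2 * v + 1)) s := by fun_prop
  have h3 : AnalyticAt ℝ (fun s : ℝ => (1 + 2 * s / lam) ^ (v - 1)) s := by
    simp only [div_eq_mul_inv]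
    fun_prop
  exact analyticAt_const.mul ((h1.div h2 (by positivity)).mul h3)

lemma integral_rpow_mul_exp_neg_mul_density_of_lt {β lam s : ℝ} (hβ : 0 < β) (hlam : 0 < lam)
    (hs : lam < s) {v : ℕ} (hv : 0 < v) {fX : ℝ → ℝ}
    (hfX : ∀ x ∈ Ioi (0:ℝ), fX x =
      2 * v * Real.Gamma β * ∑ k ∈ Finset.range v, ((v - 1).choose k : ℝ) *
        2 ^ k * lam ^ (2 * (v : ℝ) - k - 1) * x ^ (2 * (v : ℝ) - k - 2) *
          oneFOne (2 * (v : ℝ) + 1) (β + 2 * (v : ℝ) - k - 1) (-(lam * x)) /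
            Real.Gamma (β + 2 * (v : ℝ) - k - 1)) :
    ∫ x in Ioi (0 : ℝ), fX x * (x ^ β * Real.exp (-(s * x))) = weightedLaplace β lam v s := by
  have hs0 : 0 < s := hlam.trans hs
  have hc {k : ℕ} (hk : k ∈ Finset.range v) : 0 < β + 2 * (v : ℝ) - k - 1 := by
    have h1 : (k : ℝ) + 1 ≤ v := by exact_mod_cast Finset.mem_range.1 hk
    linarith [k.cast_nonneg (α := ℝ)]
  set B : ℕ → ℝ := fun k => ((v - 1).choose k : ℝ) * 2 ^ k * lam ^ (2 * (v : ℝ) - k - 1) /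
    Real.Gamma (β + 2 * (v : ℝ) - k - 1) with hB
  set G : ℕ → ℝ → ℝ := fun k x => x ^ (β + 2 * (v : ℝ) - k - 1 - 1) * Real.exp (-(s * x)) *
    oneFOne (2 * (v : ℝ) + 1) (β + 2 * (v : ℝ) - k - 1) (-(lam * x)) with hG
  have hGint {k : ℕ} (hk : k ∈ Finset.range v) : IntegrableOn (G k) (Ioi 0) := by
    have := integrableOn_rpow_mul_exp_neg_mul_oneFOne (hc hk) hlam hs (2 * v)
    push_cast at this
    exact this
  have hGval {k : ℕ} (hk : k ∈ Finset.range v) : ∫ x in Ioi (0 : ℝ), G k x =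
      Real.Gamma (β + 2 * (v : ℝ) - k - 1) * (1 / s) ^ (β + 2 * (v : ℝ) - k - 1) *
        (s / (s + lam)) ^ (2 * v + 1) := by
    have := integral_rpow_mul_exp_neg_mul_oneFOne (hc hk) hlam hs (2 * v)
    push_cast at this
    exact this
  have hsplit : ∀ x ∈ Ioi (0 : ℝ), fX x * (x ^ β * Real.exp (-(s * x))) =
      2 * v * Real.Gamma β * ∑ k ∈ Finset.range v, B k * G k x := fun x hx => by
    rw [hfX x hx, mul_assoc, Finset.sum_mul]
    congr 1
    refine Finset.sum_congr rfl fun k _ => ?_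
    have : β + 2 * (v : ℝ) - k - 1 - 1 = (2 * (v : ℝ) - k - 2) + β := by ring
    simp only [hB, hG]
    rw [this, Real.rpow_add hx]
    ring
  have hterm {k : ℕ} (hk : k ∈ Finset.range v) : B k * ∫ x in Ioi (0 : ℝ), G k x =
      lam ^ (2 * (v : ℝ) - 1) * (s ^ (2 - β) / (s + lam) ^ (2 * v + 1)) *
        ((2 * s / lam) ^ k * 1 ^ (v - 1 - k) * ((v - 1).choose k : ℝ)) := by
    have hΓ := (Real.Gamma_pos_of_pos (hc hk)).ne'
    have e1 : lam ^ (2 * (v : ℝ) - k - 1) = lam ^ (2 * (v : ℝ) - 1) / lam ^ k := by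
      rw [sub_right_comm, Real.rpow_sub hlam, Real.rpow_natCast]
    have e2 : (1 / s) ^ (β + 2 * (v : ℝ) - k - 1) = s ^ (2 - β) / s ^ (2 * v + 1) * s ^ k := by
      rw [one_div, Real.inv_rpow hs0.le, ← Real.rpow_neg hs0.le, ← Real.rpow_natCast,
        ← Real.rpow_natCast, ← Real.rpow_sub hs0, ← Real.rpow_add hs0]
      congr 1
      push_cast
      ring
    rw [hGval hk, e2, one_pow, div_pow, div_pow, mul_pow]
    simp only [hB]
    rw [e1]
    field_simp
  rw [setIntegral_congr_fun measurableSet_Ioi hsplit, integral_const_mul,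
    integral_finsetSum _ fun k hk => (hGint hk).const_mul _]
  simp_rw [integral_const_mul]
  rw [Finset.sum_congr rfl fun k hk => hterm hk, ← Finset.mul_sum, weightedLaplace,
    add_comm 1 (2 * s / lam), add_pow (2 * s / lam), Nat.sub_add_cancel hv]
  ring

/-- Analytic continuation from `s > lam` to `s > 0`. -/
lemma integral_rpow_mul_exp_neg_mul_density {β lam : ℝ} (hβ : 0 < β) (hlam : 0 < lam)
    {v : ℕ} (hv : 0 < v) {fX : ℝ → ℝ}
    (hfX : ∀ x ∈ Ioi (0:ℝ), fX x =
      2 * v * Real.Gamma β * ∑ k ∈ Finset.range v, ((v - 1).choose k : ℝ) *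
        2 ^ k * lam ^ (2 * (v : ℝ) - k - 1) * x ^ (2 * (v : ℝ) - k - 2) *
          oneFOne (2 * (v : ℝ) + 1) (β + 2 * (v : ℝ) - k - 1) (-(lam * x)) /
            Real.Gamma (β + 2 * (v : ℝ) - k - 1))
    (hfX0 : ∀ x ∈ Ioi (0:ℝ), 0 ≤ fX x) {μ : Measure ℝ} [IsFiniteMeasure μ]
    (hμ : ∀ᵐ x ∂μ, 0 < x)
    (hX : μ = (volume.restrict (Ioi 0)).withDensity fun x => ENNReal.ofReal (fX x))
    {s : ℝ} (hs : 0 < s) :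
    ∫ x, x ^ β * Real.exp (-(s * x)) ∂μ = weightedLaplace β lam v s := by
  have hmeas : AEMeasurable fX (volume.restrict (Ioi 0)) := by
    refine AEMeasurable.congr ?_ ((ae_restrict_mem measurableSet_Ioi).mono
      fun x hx => (hfX x hx).symm)
    have := fun k : ℕ => (measurable_oneFOne (2 * (v : ℝ) + 1) (β + 2 * (v : ℝ) - k - 1)).comp
      (measurable_id.const_mul lam).neg
    refine (Measurable.const_mul (Finset.measurable_sum _ fun k _ => ?_) _).aemeasurable
    exact (Measurable.mul (by fun_prop) (this k)).div_const _
  have hlarge {t : ℝ} (ht : lam < t) :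
      ∫ x, x ^ β * Real.exp (-(t * x)) ∂μ = weightedLaplace β lam v t := by
    rw [← integral_rpow_mul_exp_neg_mul_density_of_lt hβ hlam ht hv hfX, hX,
      integral_withDensity_eq_integral_toReal_smul₀ hmeas.ennreal_ofReal (by simp)]
    refine setIntegral_congr_fun measurableSet_Ioi fun x hx => ?_
    simp only [ENNReal.toReal_ofReal (hfX0 x hx), smul_eq_mul]
  exact (analyticOnNhd_integral_rpow_mul_exp_neg_mul hμ hβ).eqOn_of_preconnected_of_eventuallyEq
    (analyticOnNhd_weightedLaplace β hlam v) isPreconnected_Ioi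
    (z₀ := lam + 1) (by simp only [mem_Ioi]; positivity)
    (Filter.eventually_of_mem (Ioi_mem_nhds (lt_add_one lam)) fun t ht => hlarge ht) hs

lemma mul_weightedLaplace_eq {β lam : ℝ} (hβ : 0 < β) (hlam : 0 < lam) {v : ℕ} (hv : 0 < v)
    {z : ℝ} (hz : z ∈ Ioo (0 : ℝ) 1) :
    lam ^ β * (1 / z - 1) ^ (β - 1) / (z ^ 2 * Real.Gamma β) *
      weightedLaplace β lam v (lam * (1 / z - 1)) =
      2 * v * z ^ (v - 1) * (1 - z) * (2 - z) ^ (v - 1) := by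
  obtain ⟨n, rfl⟩ := Nat.exists_eq_add_of_le' hv
  have hz0 : 0 < z := hz.1
  have hΓ := (Real.Gamma_pos_of_pos hβ).ne'
  have hq : 0 < 1 / z - 1 := by linarith [one_lt_one_div hz.1 hz.2]
  have e1 : lam ^ β * lam ^ (2 * ((n + 1 : ℕ) : ℝ) - 1) * lam ^ (2 - β) =
      lam ^ (2 * (n + 1) + 1) := by
    rw [← Real.rpow_add hlam, ← Real.rpow_add hlam, ← Real.rpow_natCast]
    congr 1
    push_cast
    ring
  have e2 : (1 / z - 1) ^ (β - 1) * (1 / z - 1) ^ (2 - β) = (1 - z) / z := by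
    rw [← Real.rpow_add hq, sub_add_sub_cancel', show (2 : ℝ) - 1 = 1 by norm_num,
      Real.rpow_one]
    field_simp
  have e3 : lam * (1 / z - 1) + lam = lam / z := by ring
  have e4 : 1 + 2 * (lam * (1 / z - 1)) / lam = (2 - z) / z := by
    field_simp
    ring
  rw [weightedLaplace, e3, e4, Real.mul_rpow hlam.le hq.le, div_pow, div_pow,
    Nat.add_sub_cancel]
  calc _ = (lam ^ β * lam ^ (2 * ((n + 1 : ℕ) : ℝ) - 1) * lam ^ (2 - β)) *
        ((1 / z - 1) ^ (β - 1) * (1 / z - 1) ^ (2 - β)) *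
        (2 * ((n + 1 : ℕ) : ℝ) * Real.Gamma β / (z ^ 2 * Real.Gamma β) /
          (lam ^ (2 * (n + 1) + 1) / z ^ (2 * (n + 1) + 1)) * ((2 - z) ^ n / z ^ n)) := by ring
    _ = _ := by
      rw [e1, e2]
      field_simp
      ring

theorem topp_leone_ratio
    {Ω : Type*} [MeasurableSpace Ω] (P : Measure Ω) [IsProbabilityMeasure P]
    (β lam : ℝ) (hβ : 0 < β) (hlam : 0 < lam) (v : ℕ) (hv : 0 < v)
    (X Y : Ω → ℝ) (hXm : Measurable X) (hYm : Measurable Y)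
    (hindep : IndepFun X Y P)
    (hXpos : ∀ᵐ ω ∂P, 0 < X ω) (hYpos : ∀ᵐ ω ∂P, 0 < Y ω)
    (fX : ℝ → ℝ)
    (hfX : ∀ x ∈ Ioi (0:ℝ), fX x =
      2 * v * Real.Gamma β * ∑ k ∈ Finset.range v, ((v - 1).choose k : ℝ) *
        2 ^ k * lam ^ (2 * (v : ℝ) - k - 1) * x ^ (2 * (v : ℝ) - k - 2) *
          oneFOne (2 * (v : ℝ) + 1) (β + 2 * (v : ℝ) - k - 1) (-(lam * x)) /
            Real.Gamma (β + 2 * (v : ℝ) - k - 1))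
    (hfX0 : ∀ x ∈ Ioi (0:ℝ), 0 ≤ fX x)
    (hX : P.map X = (volume.restrict (Ioi 0)).withDensity
      (fun x => ENNReal.ofReal (fX x)))
    (hY : P.map Y = (volume.restrict (Ioi 0)).withDensity
      (fun y => ENNReal.ofReal (lam ^ β * y ^ (β - 1) * Real.exp (-(lam * y)) /
        Real.Gamma β))) :
    P.map (fun ω => X ω / (X ω + Y ω)) = (volume.restrict (Ioo 0 1)).withDensity
      (fun z => ENNReal.ofReal (2 * v * z ^ (v - 1) * (1 - z) * (2 - z) ^ (v - 1))) := by
  set μ := P.map X with hμdef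
  have : IsProbabilityMeasure μ := Measure.isProbabilityMeasure_map hXm.aemeasurable
  have hμ : ∀ᵐ x ∂μ, 0 < x := (ae_map_iff hXm.aemeasurable measurableSet_Ioi).2 hXpos
  have hcomp : (fun ω => X ω / (X ω + Y ω)) =
      (fun p : ℝ × ℝ => p.1 / (p.1 + p.2)) ∘ fun ω => (X ω, Y ω) := rfl
  rw [hcomp, ← Measure.map_map (by fun_prop) (hXm.prodMk hYm),
    (indepFun_iff_map_prod_eq_prod_map_map hXm.aemeasurable hYm.aemeasurable).1 hindep, hY,
    map_div_add_prod_withDensity hμ (by fun_prop)]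
  refine withDensity_congr_ae ?_
  filter_upwards [ae_restrict_mem measurableSet_Ioo] with z hz
  have hq : 0 < 1 / z - 1 := by linarith [one_lt_one_div hz.1 hz.2]
  have hs : 0 < lam * (1 / z - 1) := mul_pos hlam hq
  have hΓ := Real.Gamma_pos_of_pos hβ
  have hz0 : 0 < z := hz.1
  rw [← mul_weightedLaplace_eq hβ hlam hv hz,
    ← integral_rpow_mul_exp_neg_mul_density hβ hlam hv hfX hfX0 hμ hX hs, ← integral_const_mul,
    ofReal_integral_eq_lintegral_ofReal
      ((integrable_rpow_mul_exp_neg_mul hμ hβ hs).const_mul _)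
      (by filter_upwards [hμ] with x hx; simp only [Pi.zero_apply]; positivity)]
  refine lintegral_congr_ae ?_
  filter_upwards [hμ] with x hx
  rw [← ENNReal.ofReal_mul (by positivity), Real.mul_rpow hx.le hq.le]
  congr 1
  have hxβ : x ^ β = x * x ^ (β - 1) := by
    rw [← Real.rpow_one_add' hx.le (by simpa using hβ.ne'), add_sub_cancel]
  rw [hxβ, show lam * (x * (1 / z - 1)) = lam * (1 / z - 1) * x by ring]
  field_simp
end
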